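/- arXiv:2506.21079 — 5 statements merged into one kernel-verified Lean document; each statement's English description precedes it below -/
import Mathlib

section
/- Let E be a finite set, D ⊂ ℝ^d, and (P_x)_{x∈D} a family of stochastic matrices on E such that: (i) there exist k ∈ ℕ and θ ∈ (0,1) with ‖μ P_x^k − ν P_x^k‖_TV ≤ θ ‖μ − ν‖_TV for all probability measures μ, ν on E and all x ∈ D (uniform k-step contraction, which follows from a uniform Doeblin condition with θ = 1 − c); and (ii) there is L_P > 0 with ‖P_x − P_y‖_op ≤ L_P ‖x − y‖ for all x, y ∈ D. Let μ_x denote the unique invariant probability measure of P_x. Then x ↦ μ_x is Lipschitz: for all x, y ∈ D, ‖μ_x − μ_y‖_TV ≤ (k L_P / (1 − θ)) ‖x − y‖. -/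
/-- `p` is a probability vector on the finite set `E`. -/
def IsProbVec {E : Type*} [Fintype E] (p : E → ℝ) : Prop :=
  (∀ i, 0 ≤ p i) ∧ ∑ i, p i = 1

/-- `P` is a (row-)stochastic matrix on the finite set `E`. -/
def IsStochasticMatrix {E : Type*} [Fintype E] (P : Matrix E E ℝ) : Prop :=
  ∀ i, IsProbVec (P i)

/-- Total variation norm of a signed vector on a finite set. -/
noncomputable def tvNorm {E : Type*} [Fintype E] (v : E → ℝ) : ℝ :=
  (1 / 2) * ∑ j, |v j|

/-- Operator norm `‖Q‖_op = sup_{ν ∈ 𝒫(E)} ‖νQ‖_TV`. -/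
noncomputable def opNorm {E : Type*} [Fintype E] (Q : Matrix E E ℝ) : ℝ :=
  ⨆ ν : { p : E → ℝ // IsProbVec p }, tvNorm (Matrix.vecMul ν.1 Q)

theorem tvNorm_add_le {E : Type*} [Fintype E] (v w : E → ℝ) :
    tvNorm (v + w) ≤ tvNorm v + tvNorm w := by
  unfold tvNorm
  rw [← mul_add, ← Finset.sum_add_distrib]
  gcongr with j
  exact abs_add_le _ _

theorem tvNorm_vecMul_le {E : Type*} [Fintype E] (P : Matrix E E ℝ)
    (hP : IsStochasticMatrix P) (v : E → ℝ) :
    tvNorm (Matrix.vecMul v P) ≤ tvNorm v := by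
  unfold tvNorm
  gcongr 1 / 2 * ?_
  calc ∑ j, |Matrix.vecMul v P j| ≤ ∑ j, ∑ i, |v i| * P i j := by
        gcongr with j
        refine (Finset.abs_sum_le_sum_abs _ _).trans (Finset.sum_le_sum fun i _ => ?_)
        rw [abs_mul, abs_of_nonneg ((hP i).1 j)]
    _ = ∑ i, |v i| := by
        rw [Finset.sum_comm]
        refine Finset.sum_congr rfl fun i _ => ?_
        rw [← Finset.mul_sum, (hP i).2, mul_one]

theorem tvNorm_le_opNorm {E : Type*} [Fintype E] (Q : Matrix E E ℝ) (ν : E → ℝ)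
    (hν : IsProbVec ν) : tvNorm (Matrix.vecMul ν Q) ≤ opNorm Q := by
  refine le_ciSup (f := fun ν : { p : E → ℝ // IsProbVec p } => tvNorm (Matrix.vecMul ν.1 Q))
    ?_ ⟨ν, hν⟩
  refine ⟨1 / 2 * ∑ j, ∑ i, |Q i j|, ?_⟩
  rintro _ ⟨⟨p, hp⟩, rfl⟩
  simp only [tvNorm]
  gcongr 1 / 2 * ?_
  refine Finset.sum_le_sum fun j _ => ?_
  refine (Finset.abs_sum_le_sum_abs _ _).trans (Finset.sum_le_sum fun i _ => ?_)
  rw [abs_mul, abs_of_nonneg (hp.1 i)]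
  have h1 : p i ≤ 1 := hp.2 ▸ Finset.single_le_sum (fun i _ => hp.1 i) (Finset.mem_univ i)
  exact mul_le_of_le_one_left (abs_nonneg _) h1

/-- Under a uniform `k`-step total-variation contraction with factor
`θ ∈ (0,1)` and an `L_P`-Lipschitz dependence `x ↦ P_x` in operator norm, the
invariant probability measures satisfy
`‖μ_x − μ_y‖_TV ≤ (k L_P / (1 − θ)) ‖x − y‖` for all `x, y ∈ D`. -/
theorem invariant_measure_lipschitz {d : ℕ} {E : Type*} [Fintype E] [DecidableEq E] [Nonempty E]
    (D : Set (EuclideanSpace ℝ (Fin d)))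
    (P : EuclideanSpace ℝ (Fin d) → Matrix E E ℝ)
    (hstoch : ∀ x ∈ D, IsStochasticMatrix (P x))
    (k : ℕ) (hk : 1 ≤ k) (θ : ℝ) (hθ : θ ∈ Set.Ioo (0 : ℝ) 1)
    (hcontr : ∀ x ∈ D, ∀ μ ν : E → ℝ, IsProbVec μ → IsProbVec ν →
      tvNorm (Matrix.vecMul μ (P x ^ k) - Matrix.vecMul ν (P x ^ k)) ≤ θ * tvNorm (μ - ν))
    (L_P : ℝ) (hL : 0 < L_P)
    (hLip : ∀ x ∈ D, ∀ y ∈ D, opNorm (P x - P y) ≤ L_P * ‖x - y‖)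
    (μ : EuclideanSpace ℝ (Fin d) → E → ℝ)
    (hinv : ∀ x ∈ D, IsProbVec (μ x) ∧ Matrix.vecMul (μ x) (P x) = μ x)
    (huniq : ∀ x ∈ D, ∀ ν : E → ℝ, IsProbVec ν → Matrix.vecMul ν (P x) = ν → ν = μ x) :
    ∀ x ∈ D, ∀ y ∈ D,
      tvNorm (μ x - μ y) ≤ (k * L_P / (1 - θ)) * ‖x - y‖ := by
  intro x hx y hy
  have hstep : ∀ n : ℕ, tvNorm (Matrix.vecMul (μ y) (P x ^ n) - μ y) ≤ n * (L_P * ‖x - y‖) := by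
    intro n
    induction n with
    | zero => simp [tvNorm]
    | succ n ih =>
      have e : Matrix.vecMul (μ y) (P x ^ (n + 1)) - μ y
          = Matrix.vecMul (Matrix.vecMul (μ y) (P x ^ n) - μ y) (P x)
            + Matrix.vecMul (μ y) (P x - P y) := by
        rw [Matrix.sub_vecMul, Matrix.vecMul_sub, (hinv y hy).2, Matrix.vecMul_vecMul, pow_succ]
        abel
      rw [e]
      have h1 := tvNorm_add_le (Matrix.vecMul (Matrix.vecMul (μ y) (P x ^ n) - μ y) (P x))
        (Matrix.vecMul (μ y) (P x - P y))
      have h2 := tvNorm_vecMul_le (P x) (hstoch x hx) (Matrix.vecMul (μ y) (P x ^ n) - μ y)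
      have h3 := tvNorm_le_opNorm (P x - P y) (μ y) (hinv y hy).1
      have h4 := hLip x hx y hy
      push_cast
      linarith
  have hpow : ∀ n : ℕ, Matrix.vecMul (μ x) (P x ^ n) = μ x := by
    intro n
    induction n with
    | zero => simp
    | succ n ih => rw [pow_succ, ← Matrix.vecMul_vecMul, ih, (hinv x hx).2]
  have h1 := hcontr x hx (μ x) (μ y) (hinv x hx).1 (hinv y hy).1
  have h2 := tvNorm_add_le (Matrix.vecMul (μ x) (P x ^ k) - Matrix.vecMul (μ y) (P x ^ k))
    (Matrix.vecMul (μ y) (P x ^ k) - μ y)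
  have h3 := hstep k
  rw [sub_add_sub_cancel, hpow k] at h2
  rw [hpow k] at h1
  have hθ' : 0 < 1 - θ := by linarith [hθ.2]
  rw [div_mul_eq_mul_div, le_div_iff₀ hθ']
  linarith
end

section
/- Let (G_n)_{n∈ℕ} be a Markov chain on a finite state space E with transition matrix P, and let μ^n denote the distribution of G_n. Suppose P satisfies the Doeblin condition: there exist an integer k ≥ 1, a constant c > 0, and a probability measure q on E such that P^k(i,j) ≥ c·q(j) for all i, j ∈ E. Then P has a unique invariant probability measure μ, and for every n ∈ ℕ, ‖μ^n − μ‖_TV = (1/2) Σ_{g∈E} |μ^n(g) − μ(g)| ≤ (1 − c)^{⌊n/k⌋}. -/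
open Matrix in
lemma db_sum {E : Type*} [Fintype E] (Q : Matrix E E ℝ) (hQ : ∀ i, ∑ j, Q i j = 1) (v : E → ℝ) :
    ∑ j, (v ᵥ* Q) j = ∑ i, v i := by
  simp only [Matrix.vecMul, dotProduct]
  rw [Finset.sum_comm]
  refine Finset.sum_congr rfl fun i _ => ?_
  rw [← Finset.mul_sum, hQ, mul_one]

open Matrix in
lemma db_contr {E : Type*} [Fintype E] (Q : Matrix E E ℝ) (hQ : ∀ i, ∑ j, Q i j = 1)
    (c : ℝ) (q : E → ℝ) (hq : ∑ j, q j = 1) (h : ∀ i j, c * q j ≤ Q i j) (v : E → ℝ)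
    (hv : c * ∑ i, v i = 0) :
    ∑ j, |(v ᵥ* Q) j| ≤ (1 - c) * ∑ i, |v i| := by
  have h1 : ∀ j, |(v ᵥ* Q) j| ≤ ∑ i, |v i| * (Q i j - c * q j) := by
    intro j
    have : (v ᵥ* Q) j = ∑ i, v i * (Q i j - c * q j) := by
      simp only [Matrix.vecMul, dotProduct, mul_sub, Finset.sum_sub_distrib]
      rw [← Finset.sum_mul]
      linear_combination q j * hv
    rw [this]
    refine (Finset.abs_sum_le_sum_abs _ _).trans (Finset.sum_le_sum fun i _ => ?_)
    rw [abs_mul, abs_of_nonneg (sub_nonneg.2 (h i j))]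
  refine (Finset.sum_le_sum fun j _ => h1 j).trans (le_of_eq ?_)
  rw [Finset.sum_comm, Finset.mul_sum]
  refine Finset.sum_congr rfl fun i _ => ?_
  rw [← Finset.mul_sum, Finset.sum_sub_distrib, ← Finset.mul_sum, hQ, hq]
  ring

lemma db_pow {E : Type*} [Fintype E] [DecidableEq E] (P : Matrix E E ℝ)
    (hP : IsStochasticMatrix P) (n : ℕ) : IsStochasticMatrix (P ^ n) := by
  induction n with
  | zero =>
    intro i
    refine ⟨fun j => ?_, ?_⟩
    · rw [pow_zero, Matrix.one_apply]; split_ifs <;> norm_num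
    · simp [Matrix.one_apply]
  | succ n ih =>
    intro i
    refine ⟨fun j => ?_, ?_⟩
    · rw [pow_succ, Matrix.mul_apply]
      exact Finset.sum_nonneg fun l _ => mul_nonneg ((ih i).1 l) ((hP l).1 j)
    · rw [pow_succ]
      have := db_sum P (fun i => (hP i).2) ((P ^ n) i)
      rw [(ih i).2] at this
      simpa [Matrix.mul_apply, Matrix.vecMul, dotProduct] using this

open Matrix in
lemma db_fix {E : Type*} [Fintype E] [DecidableEq E] (P : Matrix E E ℝ) (v : E → ℝ)
    (h : v ᵥ* P = v) (n : ℕ) : v ᵥ* (P ^ n) = v := by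
  induction n with
  | zero => simp
  | succ n ih => rw [pow_succ, ← Matrix.vecMul_vecMul, ih, h]

open Matrix in
lemma db_exists {E : Type*} [Fintype E] [DecidableEq E] [Nonempty E] (P : Matrix E E ℝ)
    (hP : IsStochasticMatrix P) : ∃ μ : E → ℝ, IsProbVec μ ∧ μ ᵥ* P = μ := by
  have hdet : (P - 1).det = 0 := by
    rw [← Matrix.exists_mulVec_eq_zero_iff]
    refine ⟨fun _ => 1, ?_, ?_⟩
    · intro h
      obtain ⟨i⟩ := ‹Nonempty E›
      exact one_ne_zero (congrFun h i)
    · ext i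
      have := (hP i).2
      rw [Matrix.sub_mulVec, Matrix.one_mulVec]
      simp [Matrix.mulVec, dotProduct, this]
  obtain ⟨v, hv0, hv⟩ := Matrix.exists_vecMul_eq_zero_iff.2 hdet
  rw [Matrix.vecMul_sub, Matrix.vecMul_one, sub_eq_zero] at hv
  set w : E → ℝ := fun i => |v i| with hw
  have hle : ∀ j, w j ≤ (w ᵥ* P) j := by
    intro j
    have : w j = |∑ i, v i * P i j| := by
      conv_lhs => rw [hw, ← hv]
      rfl
    rw [this]
    refine (Finset.abs_sum_le_sum_abs _ _).trans (le_of_eq ?_)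
    simp only [Matrix.vecMul, dotProduct]
    refine Finset.sum_congr rfl fun i _ => ?_
    rw [abs_mul, abs_of_nonneg ((hP i).1 j)]
  have heq : w ᵥ* P = w := by
    have hs := (db_sum P (fun i => (hP i).2) w).symm
    rw [Finset.sum_eq_sum_iff_of_le (fun j _ => hle j)] at hs
    ext j
    exact (hs j (Finset.mem_univ j)).symm
  have hpos : 0 < ∑ i, w i := by
    obtain ⟨i, hi⟩ := Function.ne_iff.1 hv0
    exact Finset.sum_pos' (fun i _ => abs_nonneg _) ⟨i, Finset.mem_univ i, abs_pos.2 hi⟩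
  refine ⟨(∑ i, w i)⁻¹ • w, ⟨fun i => ?_, ?_⟩, ?_⟩
  · exact mul_nonneg (inv_nonneg.2 hpos.le) (abs_nonneg _)
  · simp only [Pi.smul_apply, smul_eq_mul]
    rw [← Finset.mul_sum, inv_mul_cancel₀ hpos.ne']
  · rw [Matrix.smul_vecMul, heq]

/-- Let `(G_n)` be a Markov chain on a finite state space `E`
with transition matrix `P` satisfying the Doeblin condition
`P^k(i,j) ≥ c q(j)`.  The distribution of `G_n` is `μ^n = μ^0 P^n`.  Then `P`
has a unique invariant probability measure `μ`, and
`‖μ^n − μ‖_TV ≤ (1 − c)^⌊n/k⌋` for all `n`. -/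
theorem doeblin_geometric_ergodicity {E : Type*} [Fintype E] [DecidableEq E] [Nonempty E]
    (P : Matrix E E ℝ) (hP : IsStochasticMatrix P)
    (k : ℕ) (hk : 1 ≤ k) (c : ℝ) (hc : 0 < c)
    (q : E → ℝ) (hq : IsProbVec q)
    (hDoeblin : ∀ i j, c * q j ≤ (P ^ k) i j)
    (μ0 : E → ℝ) (hμ0 : IsProbVec μ0) :
    ∃ μ : E → ℝ, (IsProbVec μ ∧ Matrix.vecMul μ P = μ) ∧
      (∀ ν : E → ℝ, IsProbVec ν → Matrix.vecMul ν P = ν → ν = μ) ∧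
      ∀ n : ℕ, tvNorm (Matrix.vecMul μ0 (P ^ n) - μ) ≤ (1 - c) ^ (n / k) := by
  obtain ⟨μ, hμ, hfix⟩ := db_exists P hP
  have hQ : ∀ n i, ∑ j, (P ^ n) i j = 1 := fun n i => (db_pow P hP n i).2
  have hc1 : c ≤ 1 := by
    obtain ⟨i⟩ := ‹Nonempty E›
    have := Finset.sum_le_sum fun j (_ : j ∈ Finset.univ) => hDoeblin i j
    rw [← Finset.mul_sum, hq.2, hQ] at this
    linarith
  refine ⟨μ, ⟨hμ, hfix⟩, ?_, ?_⟩
  · intro ν hν hνfix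
    have h0 : ∑ i, (ν - μ) i = 0 := by
      simp [Finset.sum_sub_distrib, hν.2, hμ.2]
    have h1 := db_contr (P ^ k) (hQ k) c q hq.2 hDoeblin (ν - μ) (by rw [h0, mul_zero])
    rw [db_fix P (ν - μ) (by rw [Matrix.sub_vecMul, hfix, hνfix])] at h1
    have h2 : 0 ≤ ∑ i, |(ν - μ) i| := Finset.sum_nonneg fun _ _ => abs_nonneg _
    have h3 : ∑ i, |(ν - μ) i| = 0 := by nlinarith
    rw [Finset.sum_eq_zero_iff_of_nonneg (fun _ _ => abs_nonneg _)] at h3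
    ext i
    have := abs_eq_zero.1 (h3 i (Finset.mem_univ i))
    simpa [sub_eq_zero] using this
  · intro n
    have h0 : ∑ i, (μ0 - μ) i = 0 := by
      simp [Finset.sum_sub_distrib, hμ0.2, hμ.2]
    have hvn : Matrix.vecMul μ0 (P ^ n) - μ = Matrix.vecMul (μ0 - μ) (P ^ n) := by
      rw [Matrix.sub_vecMul, db_fix P μ hfix]
    have hm : ∀ m, ∑ j, |Matrix.vecMul (μ0 - μ) (P ^ (k * m)) j| ≤ (1 - c) ^ m * 2 := by
      intro m
      induction m with
      | zero =>
        simp only [mul_zero, pow_zero, Matrix.vecMul_one, one_mul]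
        calc ∑ j, |(μ0 - μ) j| ≤ ∑ j, (μ0 j + μ j) := by
              refine Finset.sum_le_sum fun j _ => ?_
              have h1 := hμ0.1 j
              have h2 := hμ.1 j
              rw [Pi.sub_apply, abs_le]
              constructor <;> linarith
          _ ≤ 2 := by rw [Finset.sum_add_distrib, hμ0.2, hμ.2]; norm_num
      | succ m ih =>
        rw [Nat.mul_succ, pow_add, ← Matrix.vecMul_vecMul]
        refine (db_contr (P ^ k) (hQ k) c q hq.2 hDoeblin _
          (by rw [db_sum _ (hQ _), h0, mul_zero])).trans ?_
        calc _ ≤ (1 - c) * ((1 - c) ^ m * 2) :=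
              mul_le_mul_of_nonneg_left ih (by linarith)
          _ = _ := by ring
    have hr := db_contr (P ^ (n % k)) (hQ _) 0 q hq.2
      (fun i j => by rw [zero_mul]; exact (db_pow P hP _ i).1 j)
      (Matrix.vecMul (μ0 - μ) (P ^ (k * (n / k)))) (zero_mul _)
    rw [Matrix.vecMul_vecMul, ← pow_add, Nat.div_add_mod] at hr
    have := hm (n / k)
    rw [hvn, tvNorm]
    linarith
end

section
/- Let (G_n)_{n∈ℕ} be a Markov chain on a finite state space E with transition matrix P satisfying the Doeblin condition: there exist an integer k ≥ 1, a constant c > 0, and a probability measure q on E such that P^k(i,j) ≥ c·q(j) for all i, j ∈ E, and let μ be the unique invariant probability measure of P. Then for every g ∈ E, E| (1/N) Σ_{n=1}^{N} 1{G_n = g} − μ(g) | = O(N^{-1/2}) as N → ∞; i.e. there exists C > 0 such that this expectation is at most C N^{-1/2} for all N ≥ 1. -/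
open MeasureTheory

/-- `(G_n)` is a Markov chain with transition matrix `P`: conditionally on the whole
past, the next state is distributed according to `P` applied to the current state. -/
def IsMarkovChain {Ω E : Type*} [MeasurableSpace Ω] [Fintype E]
    (ℙ : Measure Ω) (G : ℕ → Ω → E) (P : Matrix E E ℝ) : Prop :=
  ∀ (n : ℕ) (path : ℕ → E) (j : E),
    (ℙ ((⋂ i ∈ Finset.range (n + 1), {ω | G i ω = path i}) ∩ {ω | G (n + 1) ω = j})).toReal =
      (ℙ (⋂ i ∈ Finset.range (n + 1), {ω | G i ω = path i})).toReal * P (path n) j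


lemma aux_pow_fix {E : Type*} [Fintype E] [DecidableEq E] (P : Matrix E E ℝ) (h : E → ℝ)
    (hh : P.mulVec h = h) (k : ℕ) : (P ^ k).mulVec h = h := by
  induction k with
  | zero => simp
  | succ k ih => rw [pow_succ, ← Matrix.mulVec_mulVec, hh, ih]

lemma aux_pow_stoch {E : Type*} [Fintype E] [DecidableEq E] (P : Matrix E E ℝ)
    (hP : IsStochasticMatrix P) (k : ℕ) : IsStochasticMatrix (P ^ k) := by
  induction k with
  | zero =>
    intro i
    refine ⟨fun j => ?_, ?_⟩
    · rw [pow_zero, Matrix.one_apply]; split_ifs <;> norm_num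
    · simp [Matrix.one_apply]
  | succ k ih =>
    intro i
    refine ⟨fun j => ?_, ?_⟩
    · rw [pow_succ, Matrix.mul_apply]
      exact Finset.sum_nonneg fun l _ => mul_nonneg ((ih i).1 l) ((hP l).1 j)
    · simp_rw [pow_succ, Matrix.mul_apply]
      rw [Finset.sum_comm]
      simp_rw [← Finset.mul_sum, (hP _).2, mul_one]
      exact (ih i).2

/-- maximum principle -/
lemma aux_max {E : Type*} [Fintype E] (Q : Matrix E E ℝ)
    (hQ : IsStochasticMatrix Q) (h : E → ℝ) (hh : Q.mulVec h = h) (i l : E)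
    (hi : ∀ j, h j ≤ h i) (hl : 0 < Q i l) : h l = h i := by
  have h1 : ∑ j, Q i j * (h i - h j) = 0 := by
    have h2 : ∑ j, Q i j * h j = h i := congrFun hh i
    simp_rw [mul_sub, Finset.sum_sub_distrib, ← Finset.sum_mul, (hQ i).2, h2]
    ring
  have h3 := (Finset.sum_eq_zero_iff_of_nonneg
    (fun j _ => mul_nonneg ((hQ i).1 j) (sub_nonneg.2 (hi j)))).1 h1 l (Finset.mem_univ _)
  rcases mul_eq_zero.1 h3 with h4 | h4 <;> linarith

lemma aux_const {E : Type*} [Fintype E] [DecidableEq E] [Nonempty E]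
    (P : Matrix E E ℝ) (hP : IsStochasticMatrix P) (k : ℕ) (c : ℝ) (hc : 0 < c)
    (q : E → ℝ) (hq : IsProbVec q) (hD : ∀ i j, c * q j ≤ (P ^ k) i j)
    (h : E → ℝ) (hh : P.mulVec h = h) (a b : E) : h a = h b := by
  obtain ⟨l, hl⟩ : ∃ l, 0 < q l := by
    by_contra! hcon
    have := Finset.sum_nonpos (fun i (_ : i ∈ Finset.univ) => hcon i)
    linarith [hq.2]
  have hpos : ∀ i, 0 < (P ^ k) i l := fun i => lt_of_lt_of_le (mul_pos hc hl) (hD i l)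
  obtain ⟨i, hi⟩ := Finite.exists_max h
  obtain ⟨j, hj⟩ := Finite.exists_min h
  have hk := aux_pow_fix P h hh k
  have e1 := aux_max _ (aux_pow_stoch P hP k) h hk i l hi (hpos i)
  have e2 := aux_max _ (aux_pow_stoch P hP k) (-h) (by rw [Matrix.mulVec_neg, hk]) j l
    (fun x => neg_le_neg (hj x)) (hpos j)
  simp only [Pi.neg_apply] at e2
  linarith [hi a, hi b, hj a, hj b]

lemma aux_poisson {E : Type*} [Fintype E] [DecidableEq E] [Nonempty E]
    (P : Matrix E E ℝ) (hP : IsStochasticMatrix P) (k : ℕ) (c : ℝ) (hc : 0 < c)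
    (q : E → ℝ) (hq : IsProbVec q) (hD : ∀ i j, c * q j ≤ (P ^ k) i j)
    (μ : E → ℝ) (hμ : IsProbVec μ) (hμinv : Matrix.vecMul μ P = μ)
    (f : E → ℝ) (hf : μ ⬝ᵥ f = 0) : ∃ h : E → ℝ, ∀ i, h i - P.mulVec h i = f i := by
  have hinv : ∀ h : E → ℝ, μ ⬝ᵥ P.mulVec h = μ ⬝ᵥ h := fun h => by
    rw [Matrix.dotProduct_mulVec, hμinv]
  have hone : ∀ a : ℝ, μ ⬝ᵥ (fun _ => a) = a := fun a => by
    simp [dotProduct, ← Finset.sum_mul, hμ.2]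
  let T : (E → ℝ) →ₗ[ℝ] (E → ℝ) :=
    { toFun := fun h => h - P.mulVec h + fun _ => μ ⬝ᵥ h
      map_add' := fun x y => by
        ext i; simp [Matrix.mulVec_add, dotProduct_add]; ring
      map_smul' := fun r x => by
        ext i; simp [Matrix.mulVec_smul, dotProduct_smul]; ring }
  have hT : ∀ h, T h = h - P.mulVec h + fun _ => μ ⬝ᵥ h := fun h => rfl
  have hTμ : ∀ h, μ ⬝ᵥ T h = μ ⬝ᵥ h := fun h => by
    rw [hT, dotProduct_add, dotProduct_sub, hinv, hone]; ring
  have hinj : Function.Injective T := by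
    rw [injective_iff_map_eq_zero]
    intro h h0
    have h1 : μ ⬝ᵥ h = 0 := by rw [← hTμ, h0, dotProduct_zero]
    have h2 : P.mulVec h = h := by
      ext i
      have := congrFun h0 i
      rw [hT] at this
      simp [h1] at this
      linarith
    have h3 := aux_const P hP k c hc q hq hD h h2
    ext i
    have h4 : h = fun _ => h i := funext fun j => h3 j i
    rw [h4, hone] at h1
    simpa using h1
  obtain ⟨h, hh⟩ := LinearMap.injective_iff_surjective.1 hinj f
  refine ⟨h, fun i => ?_⟩
  have h1 : μ ⬝ᵥ h = 0 := by rw [← hTμ, hh, hf]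
  have := congrFun hh i
  rw [hT] at this
  simpa [h1] using this

lemma aux_orth {E : Type*} [Fintype E] [DecidableEq E] [Nonempty E]
    {Ω : Type*} [MeasurableSpace Ω] (ℙ : Measure Ω) [IsProbabilityMeasure ℙ]
    (G : ℕ → Ω → E)
    (hGmeas : ∀ n (g : E), MeasurableSet {ω | G n ω = g})
    (P : Matrix E E ℝ) (hP : IsStochasticMatrix P)
    (hMC : IsMarkovChain ℙ G P) (h : E → ℝ) (n : ℕ) (S : (ℕ → E) → ℝ)
    (hS : ∀ p p' : ℕ → E, (∀ i ≤ n, p i = p' i) → S p = S p') :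
    ∫ ω, S (fun i => G i ω) * (h (G (n+1) ω) - P.mulVec h (G n ω)) ∂ℙ = 0 := by
  classical
  let e : (Fin (n+1) → E) → ℕ → E := fun p i =>
    if hi : i < n + 1 then p ⟨i, hi⟩ else Classical.arbitrary E
  let A : (Fin (n+1) → E) → E → Set Ω := fun p j =>
    (⋂ i ∈ Finset.range (n + 1), {ω | G i ω = e p i}) ∩ {ω | G (n + 1) ω = j}
  have hAm : ∀ p j, MeasurableSet (A p j) := fun p j =>
    (Finset.measurableSet_biInter _ fun i _ => hGmeas i _).inter (hGmeas _ _)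
  have hpt : ∀ ω, S (fun i => G i ω) * (h (G (n+1) ω) - P.mulVec h (G n ω)) =
      ∑ p, ∑ j, (A p j).indicator (fun _ => S (e p) * (h j - P.mulVec h (e p n))) ω := by
    intro ω
    have hne : ∀ (i : ℕ), i ≤ n → e (fun i => G i ω) i = G i ω := by
      intro i hi
      simp only [e]
      rw [dif_pos (by omega)]
    rw [Finset.sum_eq_single (fun i : Fin (n+1) => G i ω), Finset.sum_eq_single (G (n+1) ω)]
    · rw [Set.indicator_of_mem, hne n le_rfl]
      · congr 1
        exact hS _ _ fun i hi => (hne i hi).symm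
      · refine ⟨?_, rfl⟩
        simp only [Set.mem_iInter, Finset.mem_range, Set.mem_ofPred_eq]
        intro i hi
        exact (hne i (by omega)).symm
    · intro j _ hj
      exact Set.indicator_of_notMem (fun hm => hj hm.2.symm) _
    · simp
    · intro p _ hp
      refine Finset.sum_eq_zero fun j _ => Set.indicator_of_notMem (fun hm => hp ?_) _
      have h1 := hm.1
      simp only [Set.mem_iInter, Finset.mem_range, Set.mem_ofPred_eq] at h1
      ext i
      rw [h1 i i.2]
      simp only [e]
      rw [dif_pos i.2]
    · simp
  simp_rw [hpt]
  rw [integral_finsetSum]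
  · refine Finset.sum_eq_zero fun p _ => ?_
    rw [integral_finsetSum]
    · have hm := hMC n (e p)
      simp_rw [integral_indicator_const _ (hAm p _), smul_eq_mul, Measure.real]
      simp only [A, hm]
      have h1 : ∑ j, P (e p n) j * h j = P.mulVec h (e p n) := rfl
      have h2 := (hP (e p n)).2
      calc _ = (ℙ (⋂ i ∈ Finset.range (n + 1), {ω | G i ω = e p i})).toReal * S (e p) *
            (∑ j, P (e p n) j * h j - (∑ j, P (e p n) j) * P.mulVec h (e p n)) := by
            rw [Finset.sum_mul, ← Finset.sum_sub_distrib, Finset.mul_sum]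
            exact Finset.sum_congr rfl fun j _ => by ring
        _ = 0 := by rw [h1, h2]; ring
    · exact fun j _ => (integrable_const _).indicator (hAm p j)
  · exact fun p _ => integrable_finsetSum _ fun j _ =>
      (integrable_const _).indicator (hAm p j)

/-- For a Markov chain on a finite state space whose transition
matrix satisfies a Doeblin condition, with invariant probability measure `μ`, the
empirical occupation frequency of any state `g` converges to `μ(g)` in `L¹` at rate
`O(N^{-1/2})`. -/
theorem occupation_L1_rate {E : Type*} [Fintype E] [DecidableEq E] [Nonempty E]
    {Ω : Type*} [MeasurableSpace Ω] (ℙ : Measure Ω) [IsProbabilityMeasure ℙ]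
    (G : ℕ → Ω → E)
    (hGmeas : ∀ n (g : E), MeasurableSet {ω | G n ω = g})
    (P : Matrix E E ℝ) (hP : IsStochasticMatrix P)
    (hMC : IsMarkovChain ℙ G P)
    (k : ℕ) (hk : 1 ≤ k) (c : ℝ) (hc : 0 < c)
    (q : E → ℝ) (hq : IsProbVec q)
    (hDoeblin : ∀ i j, c * q j ≤ (P ^ k) i j)
    (μ : E → ℝ) (hμ : IsProbVec μ) (hμinv : Matrix.vecMul μ P = μ) :
    ∀ g : E, ∃ C > 0, ∀ N : ℕ, 1 ≤ N →
      ∫ ω, |(∑ n ∈ Finset.Icc 1 N, if G n ω = g then (1 : ℝ) else 0) / N - μ g| ∂ℙ ≤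
        C / Real.sqrt N := by
  intro g
  let f : E → ℝ := fun i => (if i = g then (1:ℝ) else 0) - μ g
  have hf : μ ⬝ᵥ f = 0 := by
    simp [dotProduct, f, mul_sub, ← Finset.sum_mul, hμ.2]
  obtain ⟨h, hh⟩ := aux_poisson P hP k c hc q hq hDoeblin μ hμ hμinv f hf
  obtain ⟨B, hB0, hB1, hB2⟩ : ∃ B : ℝ, 0 ≤ B ∧ (∀ i, |h i| ≤ B) ∧ ∀ i, |P.mulVec h i| ≤ B := by
    refine ⟨∑ i, |h i| + ∑ i, |P.mulVec h i|, by positivity, fun i => ?_, fun i => ?_⟩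
    · have := Finset.single_le_sum (fun j _ => abs_nonneg (h j)) (Finset.mem_univ i)
      have h2 : 0 ≤ ∑ i, |P.mulVec h i| := by positivity
      linarith
    · have := Finset.single_le_sum (fun j _ => abs_nonneg (P.mulVec h j)) (Finset.mem_univ i)
      have h2 : 0 ≤ ∑ i, |h i| := by positivity
      linarith
  have hmeas : ∀ (φ : E → ℝ) n, Measurable fun ω => φ (G n ω) := by
    intro φ n
    letI : MeasurableSpace E := ⊤
    have : Measurable (G n) := measurable_to_countable' fun x => hGmeas n x
    exact (measurable_from_top (f := φ)).comp this
  let D : ℕ → Ω → ℝ := fun n ω => h (G (n+1) ω) - P.mulVec h (G n ω)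
  have hDm : ∀ n, Measurable (D n) := fun n => (hmeas h (n+1)).sub (hmeas _ n)
  have hDb : ∀ n ω, |D n ω| ≤ 2 * B := fun n ω => by
    have := abs_sub (h (G (n+1) ω)) (P.mulVec h (G n ω))
    linarith [hB1 (G (n+1) ω), hB2 (G n ω)]
  let S : ℕ → Ω → ℝ := fun n ω => ∑ i ∈ Finset.range n, D i ω
  have hSm : ∀ n, Measurable (S n) := fun n => Finset.measurable_fun_sum _ fun i _ => hDm i
  have hSb : ∀ n ω, |S n ω| ≤ n * (2 * B) := fun n ω => by
    refine (Finset.abs_sum_le_sum_abs _ _).trans ?_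
    refine (Finset.sum_le_sum fun i _ => hDb i ω).trans ?_
    simp
  have hS2i : ∀ n, Integrable (fun ω => S n ω ^ 2) ℙ := fun n =>
    Integrable.of_bound ((hSm n).pow_const 2).aestronglyMeasurable ((n * (2*B))^2)
      (Filter.Eventually.of_forall fun ω => by
        rw [Real.norm_eq_abs, abs_pow]; gcongr; exact hSb n ω)
  have hSDi : ∀ n, Integrable (fun ω => S n ω * D n ω) ℙ := fun n =>
    Integrable.of_bound ((hSm n).mul (hDm n)).aestronglyMeasurable ((n * (2*B)) * (2*B))
      (Filter.Eventually.of_forall fun ω => by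
        rw [Real.norm_eq_abs, abs_mul]; gcongr
        exacts [hSb n ω, hDb n ω])
  have hS2 : ∀ n : ℕ, ∫ ω, S n ω ^ 2 ∂ℙ ≤ n * (2*B)^2 := by
    intro n
    induction n with
    | zero => simp [S]
    | succ n ih =>
      have h0 : ∫ ω, S n ω * D n ω ∂ℙ = 0 :=
        aux_orth ℙ G hGmeas P hP hMC h n
          (fun p => ∑ i ∈ Finset.range n, (h (p (i+1)) - P.mulVec h (p i)))
          (fun p p' hpp => Finset.sum_congr rfl fun i hi => by
            have := Finset.mem_range.1 hi
            rw [hpp i (by omega), hpp (i+1) (by omega)])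
      have hle : ∀ ω, S (n+1) ω ^ 2 ≤ S n ω ^ 2 + 2 * (S n ω * D n ω) + (2*B)^2 := by
        intro ω
        have e : S (n+1) ω = S n ω + D n ω := Finset.sum_range_succ _ _
        have : D n ω ^ 2 ≤ (2*B)^2 := by
          rw [← sq_abs]; gcongr; exact hDb n ω
        rw [e]; nlinarith
      have i1 : Integrable (fun ω => S n ω ^ 2 + 2 * (S n ω * D n ω)) ℙ :=
        (hS2i n).add ((hSDi n).const_mul 2)
      calc _ ≤ ∫ ω, S n ω ^ 2 + 2 * (S n ω * D n ω) + (2*B)^2 ∂ℙ :=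
            integral_mono (hS2i _) (i1.add (integrable_const _)) hle
        _ = ∫ ω, S n ω ^ 2 ∂ℙ + 2 * ∫ ω, S n ω * D n ω ∂ℙ + (2*B)^2 := by
            rw [integral_add i1 (integrable_const _), integral_add (hS2i n) ((hSDi n).const_mul 2),
              integral_const_mul]
            simp
        _ ≤ _ := by rw [h0]; push_cast; linarith
  have htel : ∀ N ω, ∑ n ∈ Finset.Icc 1 N, f (G n ω) =
      S N ω + P.mulVec h (G 0 ω) - P.mulVec h (G N ω) := by
    intro N ω
    induction N with
    | zero => simp [S]
    | succ N ih =>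
      rw [Finset.sum_Icc_succ_top (by omega), ih, ← hh]
      have e : S (N+1) ω = S N ω + D N ω := Finset.sum_range_succ _ _
      rw [e]; simp only [D]; ring
  refine ⟨2 * B^2 + 1/2 + 2 * B, by positivity, fun N hN => ?_⟩
  have hNpos : (0:ℝ) < N := by exact_mod_cast hN
  set s := Real.sqrt N with hs
  have hspos : 0 < s := Real.sqrt_pos.2 hNpos
  have hss : s * s = N := Real.mul_self_sqrt hNpos.le
  have hs1 : 1 ≤ s := Real.one_le_sqrt.2 (by exact_mod_cast hN)
  have hpt : ∀ ω, |(∑ n ∈ Finset.Icc 1 N, if G n ω = g then (1 : ℝ) else 0) / N - μ g| ≤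
      S N ω ^ 2 * (1 / (2 * s * N)) + (s / 2 + 2 * B) / N := by
    intro ω
    have e1 : (∑ n ∈ Finset.Icc 1 N, if G n ω = g then (1 : ℝ) else 0) / N - μ g =
        (S N ω + P.mulVec h (G 0 ω) - P.mulVec h (G N ω)) / N := by
      rw [← htel]
      simp only [f, Finset.sum_sub_distrib]
      simp only [Finset.sum_const, Nat.card_Icc, nsmul_eq_mul, Nat.add_sub_cancel]
      field_simp
    rw [e1, abs_div, abs_of_pos hNpos]
    have e2 : S N ω ^ 2 * (1 / (2 * s * N)) + (s / 2 + 2 * B) / N =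
      (S N ω ^ 2 / (2 * s) + s / 2 + 2 * B) / N := by field_simp; try ring
    rw [e2]
    gcongr
    have e3 : |S N ω| ≤ S N ω ^ 2 / (2 * s) + s / 2 := by
      have : S N ω ^ 2 / (2 * s) + s / 2 - |S N ω| = (|S N ω| - s)^2 / (2 * s) := by
        rw [← sq_abs]; field_simp; ring
      have h2 : 0 ≤ (|S N ω| - s)^2 / (2 * s) := by positivity
      linarith
    have b0 := abs_le.1 (hB2 (G 0 ω))
    have b1 := abs_le.1 (hB2 (G N ω))
    have b2 := abs_le.1 e3
    rw [abs_le]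
    constructor <;> linarith [b0.1, b0.2, b1.1, b1.2, b2.1, b2.2]
  have i1 : Integrable (fun ω => S N ω ^ 2 * (1 / (2 * s * N))) ℙ := (hS2i N).mul_const _
  calc _ ≤ ∫ ω, S N ω ^ 2 * (1 / (2 * s * N)) + (s / 2 + 2 * B) / N ∂ℙ :=
        integral_mono_of_nonneg (Filter.Eventually.of_forall fun ω => abs_nonneg _)
          (i1.add (integrable_const _)) (Filter.Eventually.of_forall hpt)
    _ = (∫ ω, S N ω ^ 2 ∂ℙ) * (1 / (2 * s * N)) + (s / 2 + 2 * B) / N := by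
        rw [integral_add i1 (integrable_const _), integral_mul_const]; simp
    _ ≤ (N * (2*B)^2) * (1 / (2 * s * N)) + (s / 2 + 2 * B) / N := by
        gcongr; exact hS2 N
    _ ≤ (N * (2*B)^2) * (1 / (2 * s * N)) + (s / 2 + 2 * B * s) / N := by
        have : 2 * B ≤ 2 * B * s := le_mul_of_one_le_right (by linarith) hs1
        gcongr
    _ = _ := by
        rw [← hss]; field_simp; ring
end

section
/- Let P be a stochastic matrix on a finite state space E satisfying the Doeblin condition: there exist an integer k ≥ 1, a constant c ∈ (0,1], and a probability measure q on E such that P^k(i,j) ≥ c·q(j) for all i, j ∈ E. Then the k-step kernel contracts the total variation distance: for all probability measures μ, ν on E, ‖μ P^k − ν P^k‖_TV ≤ (1 − c) ‖μ − ν‖_TV. -/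
/-- If a stochastic matrix `P` on a finite set `E` satisfies the
Doeblin condition `P^k(i,j) ≥ c q(j)` for some `k ≥ 1`, `c ∈ (0,1]` and a
probability measure `q`, then the `k`-step kernel contracts the total variation
distance with factor `1 − c`. -/
theorem doeblin_contraction {E : Type*} [Fintype E] [DecidableEq E] [Nonempty E]
    (P : Matrix E E ℝ) (hP : IsStochasticMatrix P)
    (k : ℕ) (hk : 1 ≤ k) (c : ℝ) (hc : c ∈ Set.Ioc (0 : ℝ) 1)
    (q : E → ℝ) (hq : IsProbVec q)
    (hDoeblin : ∀ i j, c * q j ≤ (P ^ k) i j) :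
    ∀ μ ν : E → ℝ, IsProbVec μ → IsProbVec ν →
      tvNorm (Matrix.vecMul μ (P ^ k) - Matrix.vecMul ν (P ^ k)) ≤ (1 - c) * tvNorm (μ - ν) := by
  intro μ ν hμ hν
  have hrow : ∀ (n : ℕ) (i : E), ∑ j, (P ^ n) i j = 1 := by
    intro n
    induction n with
    | zero => intro i; simp [Matrix.one_apply]
    | succ n ih =>
      intro i
      simp only [pow_succ, Matrix.mul_apply]
      rw [Finset.sum_comm]
      simp only [← Finset.mul_sum]
      have h : ∀ x, ∑ j, P x j = 1 := fun x => (hP x).2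
      simp [h, ih]
  have hsum : ∑ i, (μ i - ν i) = 0 := by
    rw [Finset.sum_sub_distrib, hμ.2, hν.2, sub_self]
  have hkey : ∀ j, |(Matrix.vecMul μ (P ^ k) - Matrix.vecMul ν (P ^ k)) j|
      ≤ ∑ i, |μ i - ν i| * ((P ^ k) i j - c * q j) := by
    intro j
    have e : (Matrix.vecMul μ (P ^ k) - Matrix.vecMul ν (P ^ k)) j
        = ∑ i, (μ i - ν i) * ((P ^ k) i j - c * q j) := by
      simp only [mul_sub]
      rw [Finset.sum_sub_distrib, ← Finset.sum_mul, hsum, zero_mul, sub_zero]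
      simp [Matrix.vecMul, dotProduct, sub_mul, Finset.sum_sub_distrib]
    rw [e]
    refine (Finset.abs_sum_le_sum_abs _ _).trans (le_of_eq ?_)
    refine Finset.sum_congr rfl fun i _ => ?_
    rw [abs_mul, abs_of_nonneg (sub_nonneg.2 (hDoeblin i j))]
  have htot : ∑ j, |(Matrix.vecMul μ (P ^ k) - Matrix.vecMul ν (P ^ k)) j|
      ≤ (1 - c) * ∑ i, |μ i - ν i| := by
    refine (Finset.sum_le_sum fun j _ => hkey j).trans (le_of_eq ?_)
    rw [Finset.sum_comm, Finset.mul_sum]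
    refine Finset.sum_congr rfl fun i _ => ?_
    rw [← Finset.mul_sum, Finset.sum_sub_distrib, hrow, ← Finset.mul_sum, hq.2]
    ring
  unfold tvNorm
  simp only [Pi.sub_apply] at htot ⊢
  linarith
end

section
/- Let E = S × A × S be the finite wrapped-state space, and for x ∈ ℝ^d let P_x be the stochastic matrix on E defined by P_x((s_c,a,s_n),(s_c',a',s_n')) = 1{s_n = s_c'} · π̃(x, (s_c,a,s_n), s_c')(a') · T(s_c',a')(s_n'), where π̃(x, g, s')(a') is a policy probability and T is the state transition kernel. Suppose there exist ε' > 0 and κ > 0 such that π̃(x, g, s')(a') ≥ ε' for all x, g, s', a' and T(s,a)(s') ≥ κ for all s, a, s'. Then the two-step kernel satisfies the Doeblin minorization: for all x and all g, g' ∈ E, (P_x)²(g, g') ≥ (κ ε')², uniformly in x. In particular the family (P_x) satisfies a uniform Doeblin condition with k = 2, c = (#E)(κε')² ∧ 1 and q the uniform measure on E. -/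
/-- For the wrapped kernel
`P_x(g,g') = 1{s_n = s_c'} · π̃(x,g,s_c')(a') · T(s_c',a')(s_n')`
with policy probabilities bounded below by `ε' > 0` and transition probabilities
bounded below by `κ > 0`, the two-step kernel satisfies the uniform Doeblin
minorization `(P_x)²(g,g') ≥ (κ ε')²`; in particular the family satisfies a uniform
Doeblin condition with `k = 2`, `c = (#E)(κε')² ∧ 1` and `q` the uniform measure. -/
theorem wrapped_kernel_doeblin {d : ℕ} {S A : Type*}
    [Fintype S] [Fintype A] [DecidableEq S] [DecidableEq A] [Nonempty S] [Nonempty A]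
    (πt : EuclideanSpace ℝ (Fin d) → (S × A × S) → S → A → ℝ)
    (T : S → A → S → ℝ)
    (hπProb : ∀ x g s', IsProbVec (πt x g s'))
    (hTProb : ∀ s a, IsProbVec (T s a))
    (P : EuclideanSpace ℝ (Fin d) → Matrix (S × A × S) (S × A × S) ℝ)
    (hP : ∀ (x : EuclideanSpace ℝ (Fin d)) (g g' : S × A × S),
      P x g g' = (if g.2.2 = g'.1 then (1 : ℝ) else 0) *
        πt x g g'.1 g'.2.1 * T g'.1 g'.2.1 g'.2.2)
    (ε' κ : ℝ) (hε' : 0 < ε') (hκ : 0 < κ)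
    (hπLow : ∀ x g s' a', ε' ≤ πt x g s' a')
    (hTLow : ∀ s a s', κ ≤ T s a s') :
    (∀ (x : EuclideanSpace ℝ (Fin d)) (g g' : S × A × S),
      (κ * ε') ^ 2 ≤ (P x ^ 2) g g') ∧
    (∀ (x : EuclideanSpace ℝ (Fin d)) (g g' : S × A × S),
      (min ((Fintype.card (S × A × S) : ℝ) * (κ * ε') ^ 2) 1) *
        (Fintype.card (S × A × S) : ℝ)⁻¹ ≤ (P x ^ 2) g g') := by
  have key : ∀ (x : EuclideanSpace ℝ (Fin d)) (g g' : S × A × S),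
      (κ * ε') ^ 2 ≤ (P x ^ 2) g g' := by
    intro x g g'
    have hnn : ∀ u v, 0 ≤ P x u v := by
      intro u v
      rw [hP]
      have h1 := (hπProb x u v.1).1 v.2.1
      have h2 := (hTProb v.1 v.2.1).1 v.2.2
      split_ifs <;> positivity
    have hlow : ∀ u v : S × A × S, u.2.2 = v.1 → κ * ε' ≤ P x u v := by
      intro u v h
      rw [hP, if_pos h, one_mul, mul_comm]
      exact mul_le_mul (hπLow _ _ _ _) (hTLow _ _ _) hκ.le ((hπProb x u v.1).1 v.2.1)
    obtain ⟨a⟩ := (inferInstance : Nonempty A)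
    have hpos : 0 < κ * ε' := mul_pos hκ hε'
    rw [pow_two (P x), Matrix.mul_apply, pow_two]
    calc κ * ε' * (κ * ε') ≤ P x g (g.2.2, a, g'.1) * P x (g.2.2, a, g'.1) g' :=
          mul_le_mul (hlow _ _ rfl) (hlow _ _ rfl) hpos.le (hnn _ _)
      _ ≤ _ := Finset.single_le_sum (f := fun j => P x g j * P x j g')
          (fun j _ => mul_nonneg (hnn _ _) (hnn _ _)) (Finset.mem_univ _)
  refine ⟨key, fun x g g' => le_trans ?_ (key x g g')⟩
  have hc : (0 : ℝ) < (Fintype.card (S × A × S) : ℝ) := by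
    exact_mod_cast Fintype.card_pos_iff.mpr ⟨g⟩
  rw [← div_eq_mul_inv, div_le_iff₀ hc, mul_comm ((κ * ε') ^ 2)]
  exact min_le_left _ _
end
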